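/- Let X be a set, let (V, d_V) be a metric space, let F be a set of functions f : X → V (the candidate internal representations), and let G be a set of functions g : V → [0,1], each Lipschitz with constant L > 0 (the candidate output networks). For n ≥ 1 let Hⁿ be the class of functions on Xⁿ of the form (x₁,…,xₙ) ↦ (1/n) Σ_{i=1}^n gᵢ(f(xᵢ)) with f ∈ F and g₁,…,gₙ ∈ G. Define the capacity C(ε, F) using the pseudometrics d_P(f, f') = ∫_X d_V(f(x), f'(x)) dP(x) over finitely supported probability measures P on X, and define C(ε, G) and C(ε, Hⁿ) using the pseudometrics d_Q(g,g') = ∫ |g − g'| dQ on [0,1]-valued functions. Then for all ε₁, ε₂ > 0, C(L·ε₁ + ε₂, Hⁿ) ≤ C(ε₁, F) · C(ε₂, G)ⁿ. -/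

import Mathlib

open Set

noncomputable section

/-- A finitely supported (discrete) probability measure on a set `Z`, given by nonnegative
weights summing to one on a finite support. -/
structure FinProb (Z : Type*) where
  supp : Finset Z
  w : Z → ℝ
  nonneg : ∀ z, 0 ≤ w z
  zero_outside : ∀ z ∉ supp, w z = 0
  sum_one : ∑ z ∈ supp, w z = 1

/-- The pseudometric `d_P(f,g) = ∫ dist(f z, g z) dP(z)` for a finitely supported probability
measure `P` and functions into a (pseudo)metric space. -/
def dFP {Z W : Type*} [PseudoMetricSpace W] (P : FinProb Z) (f g : Z → W) : ℝ :=
  ∑ z ∈ P.supp, P.w z * dist (f z) (g z)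

/-- `S` is an `ε`-cover of `H` w.r.t. `d_P`. -/
def IsEpsCoverFP {Z W : Type*} [PseudoMetricSpace W] (ε : ℝ) (H : Set (Z → W))
    (P : FinProb Z) (S : Finset (Z → W)) : Prop :=
  ∀ h ∈ H, ∃ s ∈ S, dFP P h s ≤ ε

/-- `N(ε, H, d_P)`: the smallest cardinality of an `ε`-cover of `H` w.r.t. `d_P`. -/
def coverNumFP {Z W : Type*} [PseudoMetricSpace W] (ε : ℝ) (H : Set (Z → W))
    (P : FinProb Z) : ℕ∞ :=
  ⨅ (S : Finset (Z → W)) (_ : IsEpsCoverFP ε H P S), (S.card : ℕ∞)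

/-- The `ε`-capacity `C(ε, H) = sup_P N(ε, H, d_P)`, supremum over finitely supported
probability measures `P`. -/
def capacityFP {Z W : Type*} [PseudoMetricSpace W] (ε : ℝ) (H : Set (Z → W)) : ℕ∞ :=
  ⨆ P : FinProb Z, coverNumFP ε H P

/-- The pushforward of a finitely supported probability measure. -/
def FinProb.map {Z Y : Type*} (P : FinProb Z) (φ : Z → Y) : FinProb Y := by
  classical
  exact
  { supp := P.supp.image φ
    w := fun y => ∑ z ∈ P.supp with φ z = y, P.w z
    nonneg := fun y => Finset.sum_nonneg fun z _ => P.nonneg z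
    zero_outside := fun y hy => by
      rw [Finset.filter_false_of_mem, Finset.sum_empty]
      intro z hz h
      exact hy (Finset.mem_image.2 ⟨z, hz, h⟩)
    sum_one := by
      rw [← P.sum_one]
      exact Finset.sum_fiberwise_of_maps_to (fun z hz => Finset.mem_image_of_mem φ hz) _ }

/-- The product of the uniform measure on `Fin n` with a finitely supported probability
measure. -/
def FinProb.uniformProd {Z : Type*} (n : ℕ) (hn : n ≠ 0) (P : FinProb Z) :
    FinProb (Fin n × Z) where
  supp := Finset.univ ×ˢ P.supp
  w p := P.w p.2 / n
  nonneg p := div_nonneg (P.nonneg _) n.cast_nonneg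
  zero_outside p hp := by
    rw [P.zero_outside p.2 (by simpa using hp), zero_div]
  sum_one := by
    rw [Finset.sum_product]
    simp only [← Finset.sum_div, P.sum_one]
    simp [hn]

theorem dFP_map {Z Y W : Type*} [PseudoMetricSpace W] (P : FinProb Z) (φ : Z → Y)
    (f g : Y → W) : dFP (P.map φ) f g = dFP P (f ∘ φ) (g ∘ φ) := by
  classical
  have h := Finset.sum_fiberwise_of_maps_to
    (fun z hz => Finset.mem_image_of_mem φ hz) (s := P.supp)
    (fun z => P.w z * dist (f (φ z)) (g (φ z)))
  simp only [dFP, FinProb.map, Function.comp_apply]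
  rw [← h]
  refine Finset.sum_congr (by congr!) fun y _ => ?_
  rw [Finset.sum_mul]
  refine Finset.sum_congr (by congr!) fun z hz => ?_
  rw [(Finset.mem_filter.1 hz).2]

theorem dFP_uniformProd {Z W : Type*} [PseudoMetricSpace W] {n : ℕ} (hn : n ≠ 0)
    (P : FinProb Z) (f g : Fin n × Z → W) :
    dFP (P.uniformProd n hn) f g =
      (∑ i, dFP P (fun z => f (i, z)) fun z => g (i, z)) / n := by
  simp only [dFP, FinProb.uniformProd]
  rw [Finset.sum_product, Finset.sum_div]
  refine Finset.sum_congr rfl fun i _ => ?_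
  rw [Finset.sum_div]
  exact Finset.sum_congr rfl fun z _ => by ring

theorem coverNumFP_le_card {Z W : Type*} [PseudoMetricSpace W] {ε : ℝ} {H : Set (Z → W)}
    {P : FinProb Z} {S : Finset (Z → W)} (hS : IsEpsCoverFP ε H P S) :
    coverNumFP ε H P ≤ S.card :=
  iInf₂_le S hS

/-- A bound on the capacity by a natural number yields covers of at most that size. -/
theorem exists_cover_card_le {Z W : Type*} [PseudoMetricSpace W] {ε : ℝ} {H : Set (Z → W)}
    {m : ℕ} (hm : capacityFP ε H ≤ m) (P : FinProb Z) :
    ∃ S : Finset (Z → W), IsEpsCoverFP ε H P S ∧ S.card ≤ m := by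
  have h : coverNumFP ε H P < (m + 1 : ℕ) :=
    ((le_iSup (coverNumFP ε H) P).trans hm).trans_lt (by exact_mod_cast m.lt_succ_self)
  simp only [coverNumFP, iInf_lt_iff] at h
  obtain ⟨S, hS, hlt⟩ := h
  exact ⟨S, hS, Nat.lt_succ_iff.1 (by exact_mod_cast hlt)⟩

theorem capacityFP_ne_zero {Z W : Type*} [PseudoMetricSpace W] {ε : ℝ} {H : Set (Z → W)}
    (P : FinProb Z) (hH : H.Nonempty) : capacityFP ε H ≠ 0 := by
  intro h
  obtain ⟨S, hS, hcard⟩ := exists_cover_card_le (m := 0) (h.trans_le zero_le) P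
  obtain ⟨f, hf⟩ := hH
  obtain ⟨s, hs, -⟩ := hS f hf
  simp [Finset.card_eq_zero.1 (Nat.le_zero.1 hcard)] at hs

/-- Composing averaged Lipschitz functions with representations: the distance is controlled by
the distance of the representations under the averaged marginal and the average distance of the
outer functions under the pushed-forward marginals. -/
theorem dFP_average_comp_le {X V : Type*} [PseudoMetricSpace V] {L : ℝ} {n : ℕ} (hn : n ≠ 0)
    (P : FinProb (Fin n → X)) (f s : X → V) (g t : Fin n → V → ℝ)
    (hg : ∀ i v v', |g i v - g i v'| ≤ L * dist v v') :
    dFP P (fun x => (∑ i, g i (f (x i))) / n) (fun x => (∑ i, t i (s (x i))) / n) ≤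
      L * dFP ((P.uniformProd n hn).map fun p => p.2 p.1) f s +
        (∑ i, dFP (P.map fun x => s (x i)) (g i) (t i)) / n := by
  simp only [dFP_map, dFP_uniformProd, Function.comp_def]
  rw [mul_div_assoc', ← add_div, Finset.mul_sum, ← Finset.sum_add_distrib]
  simp only [dFP, Finset.mul_sum, ← Finset.sum_add_distrib]
  rw [Finset.sum_comm, Finset.sum_div]
  refine Finset.sum_le_sum fun x _ => ?_
  have hx : dist ((∑ i, g i (f (x i))) / (n : ℝ)) ((∑ i, t i (s (x i))) / n) ≤
      (∑ i, (L * dist (f (x i)) (s (x i)) + dist (g i (s (x i))) (t i (s (x i))))) / n := by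
    rw [Real.dist_eq, ← sub_div, abs_div, Nat.abs_cast, ← Finset.sum_sub_distrib]
    gcongr
    refine (Finset.abs_sum_le_sum_abs _ _).trans (Finset.sum_le_sum fun i _ => ?_)
    exact (abs_sub_le _ (g i (s (x i))) _).trans (add_le_add_left (hg i _ _) _)
  refine (mul_le_mul_of_nonneg_left hx (P.nonneg x)).trans_eq ?_
  rw [mul_div_assoc', Finset.mul_sum]
  congr 1
  exact Finset.sum_congr rfl fun i _ => by ring

/-- **Capacity of composed representation classes.** Let `F` be a set of representations
`f : X → V` into a metric space `V` and let `G` be a set of `[0,1]`-valued output functions on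
`V`, each `L`-Lipschitz. For `n ≥ 1` let `Hⁿ` be the class of functions
`(x₁,…,xₙ) ↦ (1/n)∑ᵢ gᵢ(f(xᵢ))` with `f ∈ F`, `g₁,…,gₙ ∈ G`. Then for all `ε₁, ε₂ > 0`,
`C(L·ε₁ + ε₂, Hⁿ) ≤ C(ε₁, F) · C(ε₂, G)ⁿ`. -/
theorem capacity_composition {X V : Type*} [MetricSpace V]
    (F : Set (X → V)) (G : Set (V → ℝ)) (L : ℝ) (hL : 0 < L)
    (hGbdd : ∀ g ∈ G, ∀ v, g v ∈ Icc (0 : ℝ) 1)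
    (hGLip : ∀ g ∈ G, ∀ v v', |g v - g v'| ≤ L * dist v v')
    (n : ℕ) (hn : 1 ≤ n) (ε₁ ε₂ : ℝ) (hε₁ : 0 < ε₁) (hε₂ : 0 < ε₂) :
    capacityFP (L * ε₁ + ε₂)
      {h : (Fin n → X) → ℝ | ∃ f ∈ F, ∃ g : Fin n → V → ℝ, (∀ i, g i ∈ G) ∧
        h = fun x => (∑ i, g i (f (x i))) / n} ≤
      capacityFP ε₁ F * capacityFP ε₂ G ^ n := by
  classical
  have hn0 : n ≠ 0 := by lia
  refine iSup_le fun P => ?_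
  by_cases hne : F.Nonempty ∧ G.Nonempty
  swap
  · refine (coverNumFP_le_card (S := ∅) ?_).trans (by simp)
    rintro h ⟨f, hf, g, hg, -⟩
    exact (hne ⟨⟨f, hf⟩, ⟨g ⟨0, hn⟩, hg _⟩⟩).elim
  let Q := (P.uniformProd n hn0).map fun p => p.2 p.1
  have hF0 : capacityFP ε₁ F ≠ 0 := capacityFP_ne_zero Q hne.1
  have hG0 : capacityFP ε₂ G ≠ 0 := capacityFP_ne_zero (Q.map hne.1.some) hne.2
  by_cases hFtop : capacityFP ε₁ F = ⊤
  · rw [hFtop, ENat.top_mul (pow_ne_zero n hG0)]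
    exact le_top
  by_cases hGtop : capacityFP ε₂ G = ⊤
  · rw [hGtop, ENat.top_pow hn0, ENat.mul_top hF0]
    exact le_top
  obtain ⟨a, ha⟩ := ENat.ne_top_iff_exists.1 hFtop
  obtain ⟨b, hb⟩ := ENat.ne_top_iff_exists.1 hGtop
  obtain ⟨S, hS, hSa⟩ := exists_cover_card_le ha.ge Q
  choose T hT hTb using fun (s : X → V) (i : Fin n) =>
    exists_cover_card_le hb.ge (P.map fun x => s (x i))
  refine (coverNumFP_le_card (S := S.biUnion fun s => (Fintype.piFinset (T s)).image
    fun t (x : Fin n → X) => (∑ i, t i (s (x i))) / (n : ℝ)) ?_).trans ?_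
  · rintro h ⟨f, hf, g, hg, rfl⟩
    obtain ⟨s, hs, hfs⟩ := hS f hf
    choose t ht hgt using fun i => hT s i (g i) (hg i)
    refine ⟨fun x => (∑ i, t i (s (x i))) / n, Finset.mem_biUnion.2 ⟨s, hs,
      Finset.mem_image.2 ⟨t, Fintype.mem_piFinset.2 ht, rfl⟩⟩, ?_⟩
    refine (dFP_average_comp_le hn0 P f s g t fun i => hGLip _ (hg i)).trans ?_
    refine add_le_add (mul_le_mul_of_nonneg_left hfs hL.le) ?_
    rw [div_le_iff₀ (by positivity), mul_comm]
    simpa using Finset.sum_le_sum fun i (_ : i ∈ Finset.univ) => hgt i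
  · rw [← ha, ← hb]
    norm_cast
    refine (Finset.card_biUnion_le_card_mul _ _ (b ^ n) fun s _ => ?_).trans
      (Nat.mul_le_mul_right _ hSa)
    refine Finset.card_image_le.trans ?_
    rw [Fintype.card_piFinset]
    simpa using Finset.prod_le_pow_card Finset.univ (fun i => (T s i).card) b fun i _ => hTb s i
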